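/- There exists a constant C > 0 such that for every d ≥ 1, every almost-equidistant set in ℝ^d has cardinality at most C·d^{4/3}. -/

import Mathlib

open Finset Matrix

/-- The power sums of the eigenvalues of a real symmetric matrix are the traces of its powers. -/
lemma Matrix.IsHermitian.trace_pow_eq_sum_eigenvalues_pow {ι : Type*} [Fintype ι] [DecidableEq ι]
    {B : Matrix ι ι ℝ} (hB : B.IsHermitian) (m : ℕ) :
    (B ^ m).trace = ∑ i, hB.eigenvalues i ^ m := by
  conv_lhs => rw [hB.spectral_theorem, ← map_pow, Unitary.conjStarAlgAut_apply, trace_mul_comm,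
    ← mul_assoc, Unitary.coe_star_mul_self, one_mul, diagonal_pow]
  simp [trace_diagonal]

/-- A triangle-free symmetric pattern off a unit diagonal ties the third moment to the second. -/
lemma trace_pow_three_of_triangleFree {ι : Type*} [Fintype ι] [DecidableEq ι]
    {B : Matrix ι ι ℝ} (hdiag : ∀ i, B i i = 1)
    (htri : ∀ i j k, i ≠ j → j ≠ k → i ≠ k → B i j = 0 ∨ B j k = 0 ∨ B k i = 0) :
    (B ^ 3).trace = 3 * (B ^ 2).trace - 2 * Fintype.card ι := by
  obtain ⟨A, rfl⟩ : ∃ A, B = A + 1 := ⟨B - 1, by simp⟩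
  have hA0 : ∀ i, A i i = 0 := fun i => by simpa using hdiag i
  have htr : A.trace = 0 := by simp [trace, hA0]
  have hA3 : (A ^ 3).trace = 0 := by
    simp only [pow_succ, pow_zero, one_mul, trace, diag_apply, mul_apply, sum_mul]
    refine sum_eq_zero fun i _ => sum_eq_zero fun k _ => sum_eq_zero fun j _ => ?_
    by_cases hij : i = j
    · simp [hij, hA0]
    by_cases hjk : j = k
    · simp [hjk, hA0]
    by_cases hik : i = k
    · simp [hik, hA0]
    rcases htri i j k hij hjk hik with h | h | h <;>
      simp [Matrix.add_apply, one_apply, hij, hjk, Ne.symm hik] at h <;> simp [h]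
  have h2 : (A + 1) ^ 2 = A ^ 2 + A + A + 1 := by noncomm_ring
  have h3 : (A + 1) ^ 3 = A ^ 3 + (A ^ 2 + A ^ 2 + A ^ 2) + (A + A + A) + 1 := by noncomm_ring
  rw [h2, h3]
  simp only [trace_add, trace_one, htr, hA3]
  ring

/-- A symmetric matrix that is positive semidefinite on the vectors of zero sum has at most one
negative eigenvalue. -/
lemma card_neg_eigenvalues_le_one {ι : Type*} [Fintype ι] [DecidableEq ι]
    {B : Matrix ι ι ℝ} (hB : B.IsHermitian)
    (hpsd : ∀ x : ι → ℝ, ∑ i, x i = 0 → 0 ≤ x ⬝ᵥ B *ᵥ x) :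
    #{i | hB.eigenvalues i < 0} ≤ 1 := by
  rw [card_le_one]
  intro a ha b hb
  simp only [mem_filter, mem_univ, true_and] at ha hb
  by_contra hab
  set y : ι → ℝ := ⇑(hB.eigenvectorBasis a) with hy
  set z : ι → ℝ := ⇑(hB.eigenvectorBasis b) with hz
  have inner_eq (s t : ι) : (⇑(hB.eigenvectorBasis s) : ι → ℝ) ⬝ᵥ ⇑(hB.eigenvectorBasis t)
      = if s = t then 1 else 0 := by
    have := orthonormal_iff_ite.1 hB.eigenvectorBasis.orthonormal t s
    rw [EuclideanSpace.inner_eq_star_dotProduct] at this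
    simpa [eq_comm] using this
  have hyy : y ⬝ᵥ y = 1 := by simp [hy, inner_eq]
  have hzz : z ⬝ᵥ z = 1 := by simp [hz, inner_eq]
  have hyz : y ⬝ᵥ z = 0 := by simp [hy, hz, inner_eq, hab]
  have hzy : z ⬝ᵥ y = 0 := by rw [dotProduct_comm, hyz]
  have hBy : B *ᵥ y = hB.eigenvalues a • y := hB.mulVec_eigenvectorBasis a
  have hBz : B *ᵥ z = hB.eigenvalues b • z := hB.mulVec_eigenvectorBasis b
  have key (s t : ℝ) : (s • y + t • z) ⬝ᵥ B *ᵥ (s • y + t • z)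
      = s ^ 2 * hB.eigenvalues a + t ^ 2 * hB.eigenvalues b := by
    simp only [mulVec_add, mulVec_smul, hBy, hBz, add_dotProduct, dotProduct_add, smul_dotProduct,
      dotProduct_smul, hyy, hzz, hyz, hzy, smul_eq_mul]
    ring
  have hsum (s t : ℝ) : ∑ i, (s • y + t • z) i = s * ∑ i, y i + t * ∑ i, z i := by
    simp [sum_add_distrib, mul_sum]
  by_cases hz0 : ∑ i, z i = 0
  · have := hpsd ((0 : ℝ) • y + (1 : ℝ) • z) (by rw [hsum, hz0]; ring)
    rw [key] at this
    linarith
  · have := hpsd ((∑ i, z i) • y + (-∑ i, y i) • z) (by rw [hsum]; ring)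
    rw [key] at this
    nlinarith [mul_neg_of_pos_of_neg (pow_pos (abs_pos.2 hz0) 2) ha, sq_abs (∑ i, z i),
      mul_nonpos_of_nonneg_of_nonpos (sq_nonneg (-∑ i, y i)) hb.le]

/-- A lower bound for the rank of a symmetric matrix of trace `n` whose third moment is controlled
by its second one, in terms of its only negative eigenvalue. -/
lemma trace_pow_three_le_of_rank_le {ι : Type*} [Fintype ι] [DecidableEq ι]
    {B : Matrix ι ι ℝ} (hB : B.IsHermitian)
    (hmom : (B ^ 3).trace ≤ 3 * (B ^ 2).trace) (htr : 0 ≤ B.trace)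
    (hpsd : ∀ x : ι → ℝ, ∑ i, x i = 0 → 0 ≤ x ⬝ᵥ B *ᵥ x)
    {ν : ℝ} (hν : 0 ≤ ν) (hlow : ∀ x : ι → ℝ, -ν * (x ⬝ᵥ x) ≤ x ⬝ᵥ B *ᵥ x)
    {r : ℕ} (hr : B.rank ≤ r) :
    B.trace ^ 3 ≤ r ^ 2 * (2 * (ν ^ 3 + 3 * ν ^ 2) + 32 * r) := by
  set β := hB.eigenvalues with hβ
  have hlowβ (i : ι) : -ν ≤ β i := by
    have h := hlow ⇑(hB.eigenvectorBasis i)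
    have h1 : (⇑(hB.eigenvectorBasis i) : ι → ℝ) ⬝ᵥ ⇑(hB.eigenvectorBasis i) = 1 := by
      have := orthonormal_iff_ite.1 hB.eigenvectorBasis.orthonormal i i
      rw [EuclideanSpace.inner_eq_star_dotProduct] at this
      simpa using this
    rwa [hB.mulVec_eigenvectorBasis, dotProduct_smul, h1, smul_eq_mul, mul_one, mul_one] at h
  set P : Finset ι := {i | 0 < β i} with hP
  set N : Finset ι := {i | β i < 0} with hN
  have hPN : Disjoint P N := by
    rw [Finset.disjoint_left]
    intro i hi hi'
    simp only [hP, hN, mem_filter, mem_univ, true_and] at hi hi'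
    linarith
  have hsplit (g : ι → ℝ) (hg : ∀ i, β i = 0 → g i = 0) :
      ∑ i, g i = ∑ i ∈ P, g i + ∑ i ∈ N, g i := by
    rw [← sum_union hPN]
    refine (sum_subset (subset_univ _) fun i _ hi => hg i ?_).symm
    simp only [hP, hN, mem_union, mem_filter, mem_univ, true_and, not_or, not_lt] at hi
    exact le_antisymm hi.1 hi.2
  have hcard : #P ≤ r := by
    refine le_trans ?_ hr
    rw [hB.rank_eq_card_non_zero_eigs, Fintype.card_subtype]
    refine card_le_card fun i hi => ?_
    simp only [hP, mem_filter, mem_univ, true_and] at hi ⊢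
    exact hi.ne'
  have hNcard : #N ≤ 1 := card_neg_eigenvalues_le_one hB hpsd
  have htrP : B.trace ≤ ∑ i ∈ P, β i := by
    have h1 := hB.trace_eq_sum_eigenvalues
    simp only [RCLike.ofReal_real_eq_id, id] at h1
    have h2 := hsplit β fun _ h => h
    have h3 : ∑ i ∈ N, β i ≤ 0 := sum_nonpos fun i hi => by
      simp only [hN, mem_filter] at hi
      exact hi.2.le
    rw [h1]
    linarith
  have hneg : -(ν ^ 3 + 3 * ν ^ 2) ≤ ∑ i ∈ N, (β i ^ 3 - 3 * β i ^ 2) := by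
    have h1 : ∀ i ∈ N, -(ν ^ 3 + 3 * ν ^ 2) ≤ β i ^ 3 - 3 * β i ^ 2 := fun i hi => by
      simp only [hN, mem_filter, mem_univ, true_and] at hi
      have h4 := hlowβ i
      have h5 : (-β i) ^ 3 ≤ ν ^ 3 := by gcongr <;> linarith
      have h6 : (-β i) ^ 2 ≤ ν ^ 2 := by gcongr <;> linarith
      nlinarith
    have h2 := card_nsmul_le_sum _ _ _ h1
    have h3 : (#N : ℝ) ≤ 1 := by exact_mod_cast hNcard
    rw [nsmul_eq_mul] at h2
    nlinarith [pow_nonneg hν 3, pow_nonneg hν 2]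
  have hpos : ∑ i ∈ P, (β i ^ 3 / 2 - 16) ≤ ∑ i ∈ P, (β i ^ 3 - 3 * β i ^ 2) :=
    sum_le_sum fun i hi => by
      simp only [hP, mem_filter, mem_univ, true_and] at hi
      nlinarith [mul_nonneg (by linarith : 0 ≤ β i + 2) (sq_nonneg (β i - 4))]
  have hall : ∑ i, (β i ^ 3 - 3 * β i ^ 2) ≤ 0 := by
    rw [sum_sub_distrib, ← mul_sum, ← hB.trace_pow_eq_sum_eigenvalues_pow,
      ← hB.trace_pow_eq_sum_eigenvalues_pow]
    linarith
  rw [hsplit _ fun i h => by simp [h]] at hall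
  have hcub : ∑ i ∈ P, β i ^ 3 ≤ 2 * (ν ^ 3 + 3 * ν ^ 2) + 32 * r := by
    rw [sum_sub_distrib, ← sum_div, sum_const, nsmul_eq_mul] at hpos
    have : (#P : ℝ) ≤ r := by exact_mod_cast hcard
    linarith
  have hβP : ∀ i ∈ P, 0 ≤ β i := fun i hi => by
    simp only [hP, mem_filter] at hi
    exact hi.2.le
  calc B.trace ^ 3 ≤ (∑ i ∈ P, β i) ^ 3 := by gcongr
    _ ≤ #P ^ 2 * ∑ i ∈ P, β i ^ 3 := pow_sum_le_card_mul_sum_pow hβP 2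
    _ ≤ r ^ 2 * (2 * (ν ^ 3 + 3 * ν ^ 2) + 32 * r) := by
      gcongr
      exact sum_nonneg fun i hi => pow_nonneg (hβP i hi) 3

section Simplex

variable {E κ : Type*} [NormedAddCommGroup E] [InnerProductSpace ℝ E]
  {s : Finset κ} {q : κ → E}

/-- The circumradius of a regular unit simplex centred at the origin. -/
lemma norm_sq_vertex_of_unit_simplex
    (hq : ∀ a ∈ s, ∀ b ∈ s, a ≠ b → dist (q a) (q b) = 1) (hc : ∑ a ∈ s, q a = 0)
    {a : κ} (ha : a ∈ s) : ‖q a‖ ^ 2 = 1 / 2 - 1 / (2 * #s) := by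
  classical
  have hrow : ∀ b ∈ s, #s * ‖q b‖ ^ 2 + ∑ x ∈ s, ‖q x‖ ^ 2 = #s - 1 := fun b hb => by
    have h1 : ∑ x ∈ s, ‖q b - q x‖ ^ 2 = ∑ x ∈ s, if b = x then (0 : ℝ) else 1 :=
      sum_congr rfl fun x hx => by
        split_ifs with h
        · simp [h]
        · rw [← dist_eq_norm, hq b hb x hx h, one_pow]
    have h2 : ∑ x ∈ s, inner ℝ (q b) (q x) = 0 := by rw [← inner_sum, hc, inner_zero_right]
    simp only [norm_sub_sq_real, sum_add_distrib, sum_sub_distrib, ← mul_sum, h2, sum_const,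
      nsmul_eq_mul] at h1
    have h3 : ∑ x ∈ s, (if b = x then (0 : ℝ) else 1) = #s - 1 := by
      have : ∀ x, (if b = x then (0 : ℝ) else 1) = 1 - if b = x then 1 else 0 := fun x => by
        split_ifs <;> simp
      simp [this, hb]
    linarith
  have hpos : (0 : ℝ) < #s := by exact_mod_cast card_pos.2 ⟨a, ha⟩
  have htot := sum_congr rfl hrow
  rw [sum_add_distrib, ← mul_sum, sum_const, sum_const, nsmul_eq_mul, nsmul_eq_mul] at htot
  have hS : 2 * ∑ x ∈ s, ‖q x‖ ^ 2 = #s - 1 := by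
    apply mul_left_cancel₀ hpos.ne'
    linarith
  have := hrow a ha
  field_simp
  linarith

/-- The vertices of a regular unit simplex centred at the origin satisfy a Bessel inequality. -/
lemma sum_inner_sq_le_of_unit_simplex
    (hq : ∀ a ∈ s, ∀ b ∈ s, a ≠ b → dist (q a) (q b) = 1) (hc : ∑ a ∈ s, q a = 0) (u : E) :
    ∑ a ∈ s, inner ℝ u (q a) ^ 2 ≤ ‖u‖ ^ 2 / 2 := by
  classical
  set t : κ → ℝ := fun a => inner ℝ u (q a) with ht
  set y : E := ∑ a ∈ s, t a • q a with hy
  have ht0 : ∑ a ∈ s, t a = 0 := by rw [ht, ← inner_sum, hc, inner_zero_right]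
  have huy : inner ℝ u y = ∑ a ∈ s, t a ^ 2 := by
    simp only [hy, inner_sum, inner_smul_right, sq, ht]
  have hyy : ‖y‖ ^ 2 = (∑ a ∈ s, t a ^ 2) / 2 := by
    have hin : ∀ a ∈ s, ∀ b ∈ s, inner ℝ (q a) (q b)
        = -(1 / (2 * #s)) + (if a = b then 1 / 2 else 0 : ℝ) := fun a ha b hb => by
      split_ifs with h
      · rw [← h, real_inner_self_eq_norm_sq, norm_sq_vertex_of_unit_simplex hq hc ha]
        ring
      · have := norm_sub_sq_real (q a) (q b)
        rw [← dist_eq_norm, hq a ha b hb h, norm_sq_vertex_of_unit_simplex hq hc ha,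
          norm_sq_vertex_of_unit_simplex hq hc hb] at this
        linarith
    rw [← real_inner_self_eq_norm_sq, hy, sum_inner]
    have : ∀ a ∈ s, inner ℝ (t a • q a) (∑ b ∈ s, t b • q b) = t a ^ 2 / 2 := fun a ha => by
      rw [inner_sum]
      have : ∀ b ∈ s, inner ℝ (t a • q a) (t b • q b)
          = t a * -(1 / (2 * #s)) * t b + (if a = b then t a * t b / 2 else 0) := fun b hb => by
        rw [inner_smul_left, inner_smul_right, hin a ha b hb]
        split_ifs <;> simp <;> ring
      rw [sum_congr rfl this, sum_add_distrib, ← mul_sum, ht0, sum_ite_eq, if_pos ha]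
      ring
    rw [sum_congr rfl this, sum_div]
  have := sq_nonneg ‖u - (2 : ℝ) • y‖
  rw [norm_sub_sq_real, inner_smul_right, norm_smul, mul_pow, huy, hyy] at this
  norm_num at this
  change ∑ a ∈ s, t a ^ 2 ≤ _
  linarith

/-- A point at unit distance from at least half of the vertices of a regular unit simplex is at
distance about `1 / √2` from its centre. -/
lemma sq_norm_sq_sub_half_le_of_unit_simplex
    (hq : ∀ a ∈ s, ∀ b ∈ s, a ≠ b → dist (q a) (q b) = 1) (hc : ∑ a ∈ s, q a = 0)
    (hs : s.Nonempty) (u : E) (hj : 2 * #{a ∈ s | dist u (q a) ≠ 1} ≤ #s) :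
    (#s : ℝ) ^ 2 * (‖u‖ ^ 2 - 1 / 2) ^ 2 ≤ 32 * #{a ∈ s | dist u (q a) ≠ 1} + 1 / 2 := by
  set J := {a ∈ s | dist u (q a) ≠ 1} with hJ
  have hk : (1 : ℝ) ≤ #s := by exact_mod_cast card_pos.2 hs
  set k : ℝ := (#s : ℝ) with hkdef
  set e : ℝ := ‖u‖ ^ 2 - 1 / 2 - 1 / (2 * k) with he
  set f : κ → ℝ := fun a => dist u (q a) ^ 2 - 1 with hf
  have hfe : ∀ a ∈ s, f a = e - 2 * inner ℝ u (q a) := fun a ha => by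
    simp only [hf, dist_eq_norm, norm_sub_sq_real, norm_sq_vertex_of_unit_simplex hq hc ha, he]
    ring
  have hin : ∑ a ∈ s, inner ℝ u (q a) = 0 := by rw [← inner_sum, hc, inner_zero_right]
  have hsum : ∑ a ∈ s, f a = k * e := by
    rw [sum_congr rfl hfe, sum_sub_distrib, ← mul_sum, hin, sum_const, nsmul_eq_mul]
    ring
  have hsq : ∑ a ∈ s, f a ^ 2 ≤ k * e ^ 2 + 2 * ‖u‖ ^ 2 := by
    have h1 : ∀ a ∈ s, f a ^ 2 = e ^ 2 - 4 * e * inner ℝ u (q a) + 4 * inner ℝ u (q a) ^ 2 :=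
      fun a ha => by rw [hfe a ha]; ring
    rw [sum_congr rfl h1, sum_add_distrib, sum_sub_distrib, ← mul_sum, ← mul_sum, hin, sum_const,
      nsmul_eq_mul]
    linarith [sum_inner_sq_le_of_unit_simplex hq hc u]
  have hsupp (g : ℝ → ℝ) (hg : g 0 = 0) : ∑ a ∈ J, g (f a) = ∑ a ∈ s, g (f a) := by
    refine sum_subset (filter_subset _ _) fun a ha ha' => ?_
    have : dist u (q a) = 1 := by
      by_contra h
      exact ha' (by simp [hJ, ha, h])
    simp [hf, this, hg]
  have hcs : (k * e) ^ 2 ≤ #J * (k * e ^ 2 + 2 * ‖u‖ ^ 2) := by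
    have h1 := sq_sum_le_card_mul_sum_sq (s := J) (f := f)
    rw [hsupp (fun x => x) rfl, hsupp (fun x => x ^ 2) (by simp), hsum] at h1
    exact h1.trans (by gcongr)
  have hj' : 2 * (#J : ℝ) ≤ k := by rw [hkdef]; exact_mod_cast hj
  have hJ0 : (0 : ℝ) ≤ #J := Nat.cast_nonneg _
  set j : ℝ := (#J : ℝ)
  have hke : k * (‖u‖ ^ 2 - 1 / 2) = k * e + 1 / 2 := by
    rw [he]
    field_simp
    ring
  have hu : 2 * ‖u‖ ^ 2 * k = 2 * (k * e) + k + 1 := by linarith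
  rw [← mul_pow, hke]
  set x := k * e with hx
  have h2 : k * x ^ 2 ≤ j * (x ^ 2 + 2 * x + k + 1) := by
    have := mul_le_mul_of_nonneg_left hcs (by linarith : 0 ≤ k)
    calc k * x ^ 2 ≤ _ := this
      _ = j * (x ^ 2 + 2 * ‖u‖ ^ 2 * k) := by rw [hx]; ring
      _ = _ := by rw [hu]; ring
  have h3 : k * x ^ 2 ≤ k * (16 * j) := by
    nlinarith [mul_nonneg hJ0 (sq_nonneg (x - 2)), mul_nonneg hJ0 (sub_nonneg.2 hk),
      mul_nonneg (sub_nonneg.2 hj') (sq_nonneg x), mul_nonneg hJ0 (sq_nonneg x)]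
  have h4 : x ^ 2 ≤ 16 * j := le_of_mul_le_mul_left h3 (by linarith)
  nlinarith [sq_nonneg (x - 1 / 2)]

end Simplex

section UnitDefect

variable {ι E : Type*}

/-- The matrix with entries `1 - |pᵢ - pⱼ|²`: it vanishes exactly at the unit distances. -/
def unitDefect [MetricSpace E] (p : ι → E) : Matrix ι ι ℝ :=
  of fun i j => 1 - dist (p i) (p j) ^ 2

lemma unitDefect_apply [MetricSpace E] (p : ι → E) (i j : ι) :
    unitDefect p i j = 1 - dist (p i) (p j) ^ 2 := rfl

lemma unitDefect_eq_zero_iff [MetricSpace E] (p : ι → E) (i j : ι) :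
    unitDefect p i j = 0 ↔ dist (p i) (p j) = 1 := by
  rw [unitDefect_apply, sub_eq_zero, eq_comm, pow_eq_one_iff_of_nonneg dist_nonneg two_ne_zero]

lemma unitDefect_isHermitian [MetricSpace E] (p : ι → E) : (unitDefect p).IsHermitian := by
  ext i j
  simp [unitDefect_apply, dist_comm]

lemma rank_unitDefect_le [Fintype ι] {d : ℕ} (p : ι → EuclideanSpace ℝ (Fin d)) :
    (unitDefect p).rank ≤ d + 2 := by
  set X : Matrix ι (Fin d ⊕ Fin 2) ℝ :=
    of fun i => Sum.elim (fun a => 2 * p i a) ![1 - ‖p i‖ ^ 2, 1] with hX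
  set Y : Matrix (Fin d ⊕ Fin 2) ι ℝ :=
    of fun a j => Sum.elim (fun a => p j a) ![1, -‖p j‖ ^ 2] a with hY
  have hXY : unitDefect p = X * Y := by
    ext i j
    have hin : inner ℝ (p i) (p j) = ∑ a, p i a * p j a := by
      simp [PiLp.inner_apply, mul_comm]
    simp only [unitDefect_apply, dist_eq_norm, norm_sub_sq_real, hin, mul_apply, hX, hY, of_apply,
      Fintype.sum_sum_type, Sum.elim_inl, Sum.elim_inr, Fin.sum_univ_two, cons_val_zero,
      cons_val_one, mul_sum]
    simp only [mul_assoc]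
    ring
  calc (unitDefect p).rank ≤ X.rank := by rw [hXY]; exact rank_mul_le_left X Y
    _ ≤ d + 2 := by simpa using rank_le_card_width X

variable [NormedAddCommGroup E] [InnerProductSpace ℝ E]

lemma dotProduct_unitDefect_mulVec [Fintype ι] (p : ι → E) (c : E) (x : ι → ℝ) :
    x ⬝ᵥ unitDefect p *ᵥ x = 2 * ‖∑ i, x i • (p i - c)‖ ^ 2
      - 2 * (∑ i, (‖p i - c‖ ^ 2 - 1 / 2) * x i) * ∑ i, x i := by
  have hentry (i j : ι) : unitDefect p i j = 2 * inner ℝ (p i - c) (p j - c)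
      - (‖p i - c‖ ^ 2 - 1 / 2) - (‖p j - c‖ ^ 2 - 1 / 2) := by
    have := norm_sub_sq_real (p i - c) (p j - c)
    rw [sub_sub_sub_cancel_right] at this
    rw [unitDefect_apply, dist_eq_norm, this]
    ring
  have hnorm : ‖∑ i, x i • (p i - c)‖ ^ 2
      = ∑ i, ∑ j, x i * x j * inner ℝ (p i - c) (p j - c) := by
    rw [← real_inner_self_eq_norm_sq, sum_inner]
    refine sum_congr rfl fun i _ => ?_
    rw [inner_sum]
    refine sum_congr rfl fun j _ => ?_
    rw [real_inner_smul_left, real_inner_smul_right, mul_assoc]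
  have hcross : 2 * (∑ i, (‖p i - c‖ ^ 2 - 1 / 2) * x i) * ∑ i, x i
      = ∑ i, ∑ j, x i * x j * ((‖p i - c‖ ^ 2 - 1 / 2) + (‖p j - c‖ ^ 2 - 1 / 2)) := by
    rw [mul_assoc, two_mul, sum_mul_sum]
    nth_rewrite 2 [sum_comm]
    simp only [← sum_add_distrib]
    exact sum_congr rfl fun i _ => sum_congr rfl fun j _ => by ring
  rw [hnorm, hcross, mul_sum, ← sum_sub_distrib]
  simp only [dotProduct, mulVec, mul_sum, ← sum_sub_distrib]
  exact sum_congr rfl fun i _ => sum_congr rfl fun j _ => by rw [hentry]; ring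

lemma unitDefect_nonneg_of_sum_eq_zero [Fintype ι] (p : ι → E) (x : ι → ℝ) (hx : ∑ i, x i = 0) :
    0 ≤ x ⬝ᵥ unitDefect p *ᵥ x := by
  rw [dotProduct_unitDefect_mulVec p 0, hx, mul_zero, sub_zero]
  positivity

/-- Points that are on average close to a sphere of radius `1 / √2` have a unit defect matrix with
no very negative eigenvalue. -/
lemma unitDefect_lower_bound_of_near_sphere [Fintype ι] (p : ι → E) (c : E)
    (h : ∑ i, (‖p i - c‖ ^ 2 - 1 / 2) ^ 2 ≤ 65) (x : ι → ℝ) :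
    -(17 * √(Fintype.card ι)) * (x ⬝ᵥ x) ≤ x ⬝ᵥ unitDefect p *ᵥ x := by
  rw [dotProduct_unitDefect_mulVec p c]
  have hxx : x ⬝ᵥ x = ∑ i, x i ^ 2 := by simp [dotProduct, sq]
  have hX : 0 ≤ ∑ i, x i ^ 2 := sum_nonneg fun i _ => sq_nonneg _
  have h1 := sum_mul_sq_le_sq_mul_sq univ (fun i => ‖p i - c‖ ^ 2 - 1 / 2) x
  have h2 := sq_sum_le_card_mul_sum_sq (s := univ) (f := x)
  rw [card_univ] at h2
  rw [hxx]
  set X := ∑ i, x i ^ 2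
  set P := ∑ i, (‖p i - c‖ ^ 2 - 1 / 2) * x i
  set Q := ∑ i, x i
  have h3 : P ^ 2 ≤ 65 * X := h1.trans (by gcongr)
  have hs := Real.sq_sqrt (Nat.cast_nonneg (α := ℝ) (Fintype.card ι))
  have h4 : (P * Q) ^ 2 ≤ (17 / 2 * √(Fintype.card ι) * X) ^ 2 := by
    have h5 : P ^ 2 * Q ^ 2 ≤ (65 * X) * (Fintype.card ι * X) := by gcongr
    have h6 : (0 : ℝ) ≤ Fintype.card ι * X ^ 2 := by positivity
    rw [mul_pow, mul_pow, mul_pow, hs]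
    linarith
  have h7 := (abs_le.1 (abs_le_of_sq_le_sq h4 (by positivity))).2
  have := sq_nonneg ‖∑ i, x i • (p i - c)‖
  linarith

end UnitDefect

/-- A symmetric matrix with few nonzero entries per row, all bounded, has bounded quadratic form. -/
lemma quadratic_lower_bound_of_sparse {ι : Type*} [Fintype ι] {B : Matrix ι ι ℝ}
    (hB : B.IsHermitian) {M m : ℝ} (hM : 0 ≤ M) (hbd : ∀ i j, |B i j| ≤ M)
    (hsparse : ∀ i, (#{j | B i j ≠ 0} : ℝ) ≤ m) (x : ι → ℝ) :
    -(M * m) * (x ⬝ᵥ x) ≤ x ⬝ᵥ B *ᵥ x := by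
  have hsymm (i j : ι) : B j i = B i j := by simpa using hB.apply i j
  have hrow (i : ι) : ∑ j, |B i j| ≤ M * m := by
    calc ∑ j, |B i j| = ∑ j with B i j ≠ 0, |B i j| := by
          rw [sum_filter]
          exact sum_congr rfl fun j _ => by split_ifs with h <;> simp_all
      _ ≤ #{j | B i j ≠ 0} • M := sum_le_card_nsmul _ _ _ fun j _ => hbd i j
      _ ≤ M * m := by rw [nsmul_eq_mul, mul_comm]; gcongr; exact hsparse i
  have hswap : ∑ i, ∑ j, |B i j| * x j ^ 2 = ∑ i, ∑ j, |B i j| * x i ^ 2 := by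
    rw [sum_comm]
    exact sum_congr rfl fun i _ => sum_congr rfl fun j _ => by rw [hsymm]
  have hterm : ∑ i, ∑ j, -((|B i j| * x i ^ 2 + |B i j| * x j ^ 2) / 2) ≤ x ⬝ᵥ B *ᵥ x := by
    simp only [dotProduct, mulVec, mul_sum]
    refine sum_le_sum fun i _ => sum_le_sum fun j _ => ?_
    have h1 := neg_abs_le (B i j)
    have h2 := le_abs_self (B i j)
    nlinarith [mul_nonneg (by linarith : 0 ≤ |B i j| + B i j) (sq_nonneg (x i + x j)),
      mul_nonneg (by linarith : 0 ≤ |B i j| - B i j) (sq_nonneg (x i - x j))]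
  have hdiag : ∑ i, ∑ j, |B i j| * x i ^ 2 ≤ M * m * (x ⬝ᵥ x) := by
    simp only [dotProduct, mul_sum, ← sum_mul]
    refine sum_le_sum fun i _ => ?_
    rw [← sq]
    exact mul_le_mul_of_nonneg_right (hrow i) (sq_nonneg _)
  simp only [sum_neg_distrib, ← sum_div, sum_add_distrib, hswap] at hterm
  linarith

/-- A unit simplex in `ℝ ^ d` has at most `d + 2` vertices. -/
lemma card_le_of_pairwise_dist_eq_one {d : ℕ} (W : Finset (EuclideanSpace ℝ (Fin d)))
    (hW : ∀ a ∈ W, ∀ b ∈ W, a ≠ b → dist a b = 1) : #W ≤ d + 2 := by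
  have h : unitDefect (Subtype.val : W → EuclideanSpace ℝ (Fin d)) = 1 := by
    ext i j
    by_cases hij : i = j
    · subst hij
      simp [unitDefect_apply]
    · rw [one_apply_ne hij, unitDefect_eq_zero_iff]
      exact hW _ i.2 _ j.2 fun h => hij (Subtype.ext h)
  have := rank_unitDefect_le (Subtype.val : W → EuclideanSpace ℝ (Fin d))
  rwa [h, rank_one, Fintype.card_coe] at this

/-- An almost equidistant family whose unit defect matrix has no eigenvalue far below zero is
small. -/
lemma card_le_of_unitDefect_lower_bound {ι : Type*} [Fintype ι] [DecidableEq ι] {d : ℕ}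
    (hd : 1 ≤ d) (p : ι → EuclideanSpace ℝ (Fin d))
    (htri : ∀ i j k, i ≠ j → j ≠ k → i ≠ k →
      dist (p i) (p j) = 1 ∨ dist (p j) (p k) = 1 ∨ dist (p i) (p k) = 1)
    (hlow : ∀ x : ι → ℝ,
      -(17 * √(Fintype.card ι)) * (x ⬝ᵥ x) ≤ x ⬝ᵥ unitDefect p *ᵥ x) :
    (Fintype.card ι : ℝ) ≤ 2304 * (d : ℝ) ^ ((4 : ℝ) / 3) := by
  have hd1 : (1 : ℝ) ≤ d := by exact_mod_cast hd
  obtain ⟨D, hD, hDd, hD4⟩ : ∃ D : ℝ, 1 ≤ D ∧ D ^ 3 = d ∧ (d : ℝ) ^ ((4 : ℝ) / 3) = D ^ 4 := by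
    refine ⟨(d : ℝ) ^ ((1 : ℝ) / 3), Real.one_le_rpow hd1 (by norm_num), ?_, ?_⟩ <;>
      rw [← Real.rpow_mul_natCast (by positivity)] <;> norm_num
  have hD34 : D ^ 3 ≤ D ^ 4 := pow_le_pow_right₀ hD (by norm_num)
  rw [hD4]
  set n : ℝ := (Fintype.card ι : ℝ) with hn
  rcases le_or_gt n (d + 2) with hsmall | hbig
  · linarith
  have hdiag (i : ι) : unitDefect p i i = 1 := by simp [unitDefect_apply]
  have htrace : (unitDefect p).trace = n := by simp [trace, hdiag, hn]
  have hmom : (unitDefect p ^ 3).trace ≤ 3 * (unitDefect p ^ 2).trace := by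
    rw [trace_pow_three_of_triangleFree hdiag]
    · linarith
    · simpa only [unitDefect_eq_zero_iff, dist_comm] using fun i j k h1 h2 h3 =>
        (htri i j k h1 h2 h3).imp_right (Or.imp_right fun h => (dist_comm _ _).trans h)
  have key := trace_pow_three_le_of_rank_le (unitDefect_isHermitian p) hmom
    (by rw [htrace]; linarith) (unitDefect_nonneg_of_sum_eq_zero p) (by positivity) hlow
    (rank_unitDefect_le p)
  rw [htrace] at key
  push_cast at key
  have hs2 : √n ^ 2 = n := Real.sq_sqrt (by linarith)
  have hs1 : 1 ≤ √n := Real.one_le_sqrt.2 (by linarith)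
  set s := √n
  have hs23 : s ^ 2 ≤ s ^ 3 := pow_le_pow_right₀ hs1 (by norm_num)
  have hs3 : 0 < s ^ 3 := by positivity
  have hcube : s ^ 3 * s ^ 3 ≤ (104328 * d ^ 2) * s ^ 3 := by
    calc s ^ 3 * s ^ 3 = n ^ 3 := by rw [← hs2]; ring
      _ ≤ (d + 2) ^ 2 * (2 * ((17 * s) ^ 3 + 3 * (17 * s) ^ 2) + 32 * (d + 2)) := key
      _ ≤ (3 * d) ^ 2 * (11592 * s ^ 3) := by
        gcongr
        · linarith
        · nlinarith
      _ = (104328 * d ^ 2) * s ^ 3 := by ring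
  have hs48 : s ≤ 48 * D ^ 2 := by
    refine le_of_pow_le_pow_left₀ three_ne_zero (by positivity) ?_
    calc s ^ 3 ≤ 104328 * d ^ 2 := le_of_mul_le_mul_right hcube hs3
      _ ≤ (48 * D ^ 2) ^ 3 := by rw [← hDd]; nlinarith [pow_pos (zero_lt_one.trans_le hD) 6]
  calc n = s ^ 2 := hs2.symm
    _ ≤ (48 * D ^ 2) ^ 2 := by gcongr
    _ = 2304 * D ^ 4 := by ring

/-- If the graph of non-unit distances on `V` has maximum degree `k`, attained on a unit simplex,
then the points of `V` at unit distance from half of the simplex form most of `V`, and their unit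
defect matrix has no eigenvalue far below zero. -/
lemma exists_subset_unitDefect_lower_bound {E : Type*} [NormedAddCommGroup E]
    [InnerProductSpace ℝ E] (V W : Finset E) (hWV : W ⊆ V)
    (hW : ∀ a ∈ W, ∀ b ∈ W, a ≠ b → dist a b = 1)
    (hdeg : ∀ v ∈ V, #{w ∈ V | dist v w ≠ 1} ≤ #W + 1) (hV : 2 * (#W + 1) < #V) :
    ∃ V' ⊆ V, #V ≤ #V' + 2 * #W ∧ ∀ x : V' → ℝ,
      -(17 * √(Fintype.card V')) * (x ⬝ᵥ x) ≤ x ⬝ᵥ unitDefect (Subtype.val : V' → E) *ᵥ x := by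
  classical
  set j : E → ℕ := fun v => #{w ∈ W | dist v w ≠ 1} with hj
  have hjsum : ∑ v ∈ V, j v ≤ #W * (#W + 1) := by
    have h1 : ∑ v ∈ V, j v = ∑ w ∈ W, #{v ∈ V | dist v w ≠ 1} := by
      simp only [hj, card_filter]
      exact sum_comm
    rw [h1, ← smul_eq_mul]
    refine sum_le_card_nsmul _ _ _ fun w hw => ?_
    simpa only [dist_comm] using hdeg w (hWV hw)
  have hbad : #{v ∈ V | ¬ 2 * j v ≤ #W} ≤ 2 * #W := by
    have h1 : #{v ∈ V | ¬ 2 * j v ≤ #W} * (#W + 1) ≤ 2 * (#W * (#W + 1)) := by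
      calc #{v ∈ V | ¬ 2 * j v ≤ #W} * (#W + 1)
          ≤ ∑ v ∈ V with ¬ 2 * j v ≤ #W, 2 * j v := by
            rw [← smul_eq_mul]
            refine card_nsmul_le_sum _ _ _ fun v hv => ?_
            simp only [mem_filter] at hv
            omega
        _ ≤ ∑ v ∈ V, 2 * j v := sum_le_sum_of_subset (filter_subset _ _)
        _ ≤ 2 * (#W * (#W + 1)) := by rw [← mul_sum]; omega
    refine le_of_mul_le_mul_right ?_ (Nat.succ_pos #W)
    rwa [mul_assoc]
  have hsplit := card_filter_add_card_filter_not (s := V) (fun v => 2 * j v ≤ #W)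
  refine ⟨{v ∈ V | 2 * j v ≤ #W}, filter_subset _ _, by omega, ?_⟩
  set V' : Finset E := {v ∈ V | 2 * j v ≤ #W} with hV'
  have hV'sub : V' ⊆ V := filter_subset _ _
  have hcard : (1 : ℝ) ≤ #V' := by
    have : 1 ≤ #V' := by omega
    exact_mod_cast this
  intro x
  rcases le_or_gt ((#W : ℝ) ^ 2) #V' with hsmall | hbig
  · have hdist : ∀ v ∈ V, ∀ w ∈ V, dist v w ≤ 2 := fun v hv w hw => by
      obtain ⟨u, hu, hu'⟩ := exists_mem_notMem_of_card_lt_card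
        (s := {u ∈ V | dist v u ≠ 1} ∪ {u ∈ V | dist w u ≠ 1}) (t := V)
        ((card_union_le _ _).trans_lt (by linarith [hdeg v hv, hdeg w hw]))
      simp only [mem_union, mem_filter, hu, true_and, not_or, not_not] at hu'
      linarith [dist_triangle_right v w u]
    have h := quadratic_lower_bound_of_sparse (unitDefect_isHermitian (Subtype.val : V' → E))
      (M := 3) (m := #W + 1) (by norm_num) (fun a b => ?_) (fun a => ?_) x
    · refine le_trans ?_ h
      refine mul_le_mul_of_nonneg_right (neg_le_neg ?_)
        (sum_nonneg fun i _ => mul_self_nonneg _)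
      rw [Fintype.card_coe]
      have h1 : (#W : ℝ) ≤ √(#V') := Real.le_sqrt_of_sq_le hsmall
      have h2 : 1 ≤ √(#V' : ℝ) := Real.one_le_sqrt.2 hcard
      linarith
    · rw [unitDefect_apply, abs_le]
      have h1 := hdist a (hV'sub a.2) b (hV'sub b.2)
      have h2 : 0 ≤ dist (a : E) b := dist_nonneg
      constructor <;> nlinarith
    · have h1 : #{b : V' | unitDefect (Subtype.val : V' → E) a b ≠ 0} ≤ #W + 1 := by
        refine le_trans ?_ (hdeg a (hV'sub a.2))
        refine card_le_card_of_injOn Subtype.val (fun b hb => ?_) Subtype.val_injective.injOn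
        simp only [ne_eq, unitDefect_eq_zero_iff, coe_filter, Set.mem_ofPred_eq, mem_univ,
          true_and] at hb ⊢
        exact ⟨hV'sub b.2, hb⟩
      exact_mod_cast h1
  · have hWpos : (1 : ℝ) ≤ #W := by
      have : #W ≠ 0 := fun h => by
        rw [h] at hbig
        norm_num at hbig
        linarith
      exact_mod_cast Nat.one_le_iff_ne_zero.2 this
    have hWne : W.Nonempty := card_pos.1 (by exact_mod_cast hWpos)
    set c : E := (#W : ℝ)⁻¹ • ∑ w ∈ W, w with hc
    have hcentre : ∑ w ∈ W, (w - c) = 0 := by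
      rw [sum_sub_distrib, sum_const, ← Nat.cast_smul_eq_nsmul ℝ, hc, smul_inv_smul₀, sub_self]
      linarith
    refine unitDefect_lower_bound_of_near_sphere _ c ?_ x
    rw [sum_coe_sort V' fun v => (‖v - c‖ ^ 2 - 1 / 2) ^ 2]
    have hpt : ∀ v ∈ V', (#W : ℝ) ^ 2 * (‖v - c‖ ^ 2 - 1 / 2) ^ 2 ≤ 32 * j v + 1 / 2 :=
      fun v hv => by
        have h1 := sq_norm_sq_sub_half_le_of_unit_simplex (s := W) (q := fun w => w - c)
          (by simpa only [dist_sub_right] using hW) hcentre hWne (v - c)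
        simp only [dist_sub_right] at h1
        exact h1 (mem_filter.1 hv).2
    have hjV' : ∑ v ∈ V', (j v : ℝ) ≤ #W * (#W + 1) := by
      exact_mod_cast (sum_le_sum_of_subset hV'sub).trans hjsum
    have htot := sum_le_sum hpt
    rw [← mul_sum, sum_add_distrib, ← mul_sum, sum_const, nsmul_eq_mul] at htot
    refine le_of_mul_le_mul_left (htot.trans ?_) (by positivity : (0 : ℝ) < (#W : ℝ) ^ 2)
    nlinarith

theorem almost_equidistant_card_bound :
    ∃ C : ℝ, C > 0 ∧ ∀ d : ℕ, 1 ≤ d →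
      ∀ V : Finset (EuclideanSpace ℝ (Fin d)),
        (∀ x ∈ V, ∀ y ∈ V, ∀ z ∈ V, x ≠ y → y ≠ z → x ≠ z →
          dist x y = 1 ∨ dist y z = 1 ∨ dist x z = 1) →
        (V.card : ℝ) ≤ C * (d : ℝ) ^ ((4 : ℝ) / 3) := by
  classical
  refine ⟨2400, by norm_num, fun d hd V hV => ?_⟩
  have hd1 : (1 : ℝ) ≤ d := by exact_mod_cast hd
  have hpow : (d : ℝ) ≤ (d : ℝ) ^ ((4 : ℝ) / 3) := Real.self_le_rpow_of_one_le hd1 (by norm_num)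
  rcases V.eq_empty_or_nonempty with rfl | hne
  · simp only [card_empty, Nat.cast_zero]
    positivity
  obtain ⟨v₀, hv₀, hmax⟩ := exists_max_image V (fun v => #{w ∈ V | dist v w ≠ 1}) hne
  set W := {w ∈ V | dist v₀ w ≠ 1}.erase v₀ with hWdef
  have hWcard : #W + 1 = #{w ∈ V | dist v₀ w ≠ 1} :=
    card_erase_add_one (by simp [hv₀])
  have hWV : W ⊆ V := (erase_subset _ _).trans (filter_subset _ _)
  have hW : ∀ a ∈ W, ∀ b ∈ W, a ≠ b → dist a b = 1 := fun a ha b hb hab => by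
    simp only [hWdef, mem_erase, mem_filter] at ha hb
    rcases hV v₀ hv₀ a ha.2.1 b hb.2.1 ha.1.symm hab hb.1.symm with h | h | h
    · exact absurd h ha.2.2
    · exact h
    · exact absurd h hb.2.2
  have hWd : (#W : ℝ) ≤ d + 2 := by exact_mod_cast card_le_of_pairwise_dist_eq_one W hW
  rcases le_or_gt #V (2 * (#W + 1)) with hsmall | hbig
  · have : (#V : ℝ) ≤ 2 * (#W + 1) := by exact_mod_cast hsmall
    linarith
  obtain ⟨V', hV'V, hcard, hlow⟩ := exists_subset_unitDefect_lower_bound V W hWV hW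
    (fun v hv => (hmax v hv).trans hWcard.ge) hbig
  have hbound := card_le_of_unitDefect_lower_bound hd (Subtype.val : V' → _)
    (fun i j k hij hjk hik => hV i (hV'V i.2) j (hV'V j.2) k (hV'V k.2)
      (Subtype.coe_injective.ne hij) (Subtype.coe_injective.ne hjk)
      (Subtype.coe_injective.ne hik)) hlow
  rw [Fintype.card_coe] at hbound
  have : (#V : ℝ) ≤ #V' + 2 * #W := by exact_mod_cast hcard
  linarith
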